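/- Let n, k, λ be positive integers such that there exists a BGW(n,k,λ) over {1,−1}. Then the set of primes m for which there exists an ((m+1)n)×((m+1)n) integer matrix W with entries in {−1,0,1}, rows and columns indexed by {0,…,m}×{1,…,n}, satisfying W·Wᵀ = mk·I and |W|·|W|ᵀ = |W|ᵀ·|W| = mk·I + mλ·(𝒥_{m+1,n} − I) + ((m−1)/n)k²·(J − 𝒥_{m+1,n}) (so that |W| is the incidence matrix of an SGDD((m+1)n, mk, m+1, n, mλ, ((m−1)/n)k²)) is infinite. -/

import Mathlib

open Matrix

/-- The all-ones matrix. -/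
def allOnes (ι : Type*) : Matrix ι ι ℤ := Matrix.of fun _ _ => 1

/-- The matrix `𝒥_{m,n} = I_m ⊗ J_n`, with rows and columns indexed by pairs:
entry `((i,a),(j,b))` is `1` iff `i = j`. -/
def blockJ (m n : ℕ) : Matrix (Fin m × Fin n) (Fin m × Fin n) ℤ :=
  Matrix.of fun x y => if x.1 = y.1 then 1 else 0

section Incidence

variable {ι κ : Type*}

@[simp] lemma allOnes_apply (i j : ι) : allOnes ι i j = 1 := rfl

@[simp] lemma allOnes_transpose : (allOnes ι)ᵀ = allOnes ι := rfl

variable [Fintype κ]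

lemma allOnes_mul_allOnes :
    allOnes κ * allOnes κ = (Fintype.card κ : ℤ) • allOnes κ := by
  ext i j
  simp [Matrix.mul_apply]

/-- A symmetric integer matrix of trace zero satisfying `D² = -aD` vanishes. -/
lemma eq_zero_of_mul_self_eq_smul {D : Matrix κ κ ℤ} {a : ℤ} (hsymm : Dᵀ = D)
    (hD : D * D = -a • D) (htr : D.trace = 0) : D = 0 := by
  rw [← Matrix.trace_mul_conjTranspose_self_eq_zero_iff,
    Matrix.conjTranspose_eq_transpose_of_trivial,
    hsymm, hD, Matrix.trace_smul, htr, smul_zero]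

variable [DecidableEq κ]

lemma transpose_mul_self_eq_smul_one {A : Matrix κ κ ℤ} {k : ℤ} (h : A * Aᵀ = k • 1) :
    Aᵀ * A = k • 1 := by
  have h4 : Aᵀ * A * (Aᵀ * A) = k • (Aᵀ * A) := by
    rw [Matrix.mul_assoc, ← Matrix.mul_assoc A, h, Matrix.smul_mul, Matrix.one_mul,
      Matrix.mul_smul]
  refine sub_eq_zero.1 (eq_zero_of_mul_self_eq_smul (a := k) ?_ ?_ ?_)
  · simp
  · simp only [Matrix.sub_mul, Matrix.mul_sub, h4, Matrix.smul_mul, Matrix.mul_smul,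
      Matrix.one_mul, Matrix.mul_one]
    module
  · rw [Matrix.trace_sub, Matrix.trace_mul_comm, h, sub_self]

/-- The dual of a symmetric design, degenerate designs included, is a symmetric design with the
same parameters. -/
lemma transpose_mul_self_eq_of_mul_transpose_eq {N : Matrix κ κ ℤ} {a b k : ℤ}
    (h : N * Nᵀ = a • 1 + b • allOnes κ) (hrow : N * allOnes κ = k • allOnes κ)
    (hcol : allOnes κ * N = k • allOnes κ) (hk : k ^ 2 = a + Fintype.card κ * b) :
    Nᵀ * N = a • 1 + b • allOnes κ := by
  have hcol' : Nᵀ * allOnes κ = k • allOnes κ := by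
    simpa [-zsmul_eq_mul] using congrArg Matrix.transpose hcol
  have hrow' : allOnes κ * Nᵀ = k • allOnes κ := by
    simpa [-zsmul_eq_mul] using congrArg Matrix.transpose hrow
  have h1 : Nᵀ * N * (Nᵀ * N) = a • (Nᵀ * N) + (b * k ^ 2) • allOnes κ := by
    rw [Matrix.mul_assoc, ← Matrix.mul_assoc N, h]
    simp only [Matrix.add_mul, Matrix.mul_add, Matrix.smul_mul, Matrix.mul_smul, Matrix.one_mul,
      hcol, hcol']
    module
  have h2 : Nᵀ * N * allOnes κ = k ^ 2 • allOnes κ := by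
    rw [Matrix.mul_assoc, hrow, Matrix.mul_smul, hcol']
    module
  have h3 : allOnes κ * (Nᵀ * N) = k ^ 2 • allOnes κ := by
    rw [← Matrix.mul_assoc, hrow', Matrix.smul_mul, hcol]
    module
  refine sub_eq_zero.1 (eq_zero_of_mul_self_eq_smul (a := a) ?_ ?_ ?_)
  · simp [-zsmul_eq_mul]
  · simp only [Matrix.sub_mul, Matrix.mul_sub, h1, h2, h3, Matrix.smul_mul, Matrix.mul_smul,
      Matrix.one_mul, Matrix.mul_one, Matrix.add_mul, Matrix.mul_add, allOnes_mul_allOnes, hk]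
    module
  · rw [Matrix.trace_sub, Matrix.trace_mul_comm, h, sub_self]

/-- The absolute value of a balanced weighing matrix is the incidence matrix of a symmetric
design. -/
lemma balanced_abs {C : Matrix κ κ ℤ} {k b : ℤ} (h01 : ∀ i j, C i j = -1 ∨ C i j = 0 ∨ C i j = 1)
    (hC : C * Cᵀ = k • 1)
    (hB : (C.map fun t => |t|) * (C.map fun t => |t|)ᵀ = (k - b) • 1 + b • allOnes κ) :
    (C.map fun t => |t|) * allOnes κ = k • allOnes κ ∧
    (C.map fun t => |t|)ᵀ * (C.map fun t => |t|) = (k - b) • 1 + b • allOnes κ ∧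
    (Nonempty κ → k ^ 2 = k - b + Fintype.card κ * b) := by
  have habs : ∀ i j, |C i j| = C i j * C i j := fun i j => by
    rcases h01 i j with h | h | h <;> simp [h]
  have hrow : (C.map fun t => |t|) * allOnes κ = k • allOnes κ := by
    ext i j
    have := congrFun (congrFun hC i) i
    simpa [Matrix.mul_apply, habs] using this
  have hcol : allOnes κ * (C.map fun t => |t|) = k • allOnes κ := by
    ext i j
    have := congrFun (congrFun (transpose_mul_self_eq_smul_one hC) j) j
    simpa [Matrix.mul_apply, habs] using this
  have hk : Nonempty κ → k ^ 2 = k - b + Fintype.card κ * b := by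
    rintro ⟨i⟩
    have hcol' : (C.map fun t => |t|)ᵀ * allOnes κ = k • allOnes κ := by
      have := congrArg Matrix.transpose hcol
      rwa [Matrix.transpose_mul, allOnes_transpose, Matrix.transpose_smul, allOnes_transpose] at this
    have h1 := congrArg (· * allOnes κ) hB
    simp only [Matrix.mul_assoc, hcol', Matrix.mul_smul, hrow, Matrix.add_mul, Matrix.smul_mul,
      Matrix.one_mul, allOnes_mul_allOnes] at h1
    have h2 := congrFun (congrFun h1 i) i
    simp only [Matrix.add_apply, Matrix.smul_apply, allOnes_apply, smul_eq_mul] at h2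
    linear_combination h2
  refine ⟨hrow, ?_, hk⟩
  rcases isEmpty_or_nonempty κ with h | h
  · exact Subsingleton.elim _ _
  · exact transpose_mul_self_eq_of_mul_transpose_eq hB hrow hcol (hk h)

end Incidence

section ProjectiveLine

variable {F ι : Type*} [Field F]

/-- The determinant of a pair of plane vectors. -/
def planeDet (p q : F × F) : F := p.1 * q.2 - p.2 * q.1

lemma planeDet_swap (p q : F × F) : planeDet p q = -planeDet q p := by
  simp only [planeDet]
  ring

/-- Representatives of the points of the projective line. -/
def projPoint : Option F → F × F
  | none => (0, 1)
  | some x => (1, x)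

lemma planeDet_projPoint_eq_zero (x y : Option F) :
    planeDet (projPoint x) (projPoint y) = 0 ↔ x = y := by
  rcases x with _ | x <;> rcases y with _ | y <;> simp [planeDet, projPoint, sub_eq_zero, eq_comm]

variable [Fintype F] [Fintype ι] [DecidableEq ι] {M : Type*} [AddCommMonoid M]

lemma sum_planeDet_div {v : ι → F × F} (hv : ∀ x y, planeDet (v x) (v y) = 0 ↔ x = y)
    (hcard : Fintype.card ι = Fintype.card F + 1) {f : F → M} (hf : f 0 = 0) {x x' : ι}
    (hx : x ≠ x') :
    ∑ y, f (planeDet (v x) (v y) / planeDet (v x') (v y)) = ∑ u, f u := by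
  rw [← Finset.add_sum_erase _ _ (Finset.mem_univ x'), (hv x' x').2 rfl, div_zero, hf, zero_add]
  have hne : ∀ y ∈ Finset.univ.erase x', planeDet (v x') (v y) ≠ 0 := fun y hy h =>
    (Finset.mem_erase.1 hy).1 ((hv _ _).1 h).symm
  have hinj : Set.InjOn (fun y => planeDet (v x) (v y) / planeDet (v x') (v y))
      (Finset.univ.erase x' : Finset ι) := by
    intro y hy y' hy' h
    have h1 := hne y hy
    have h2 := hne y' hy'
    simp only [div_eq_div_iff h1 h2] at h
    have h3 : planeDet (v x) (v x') * planeDet (v y) (v y') = 0 := by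
      simp only [planeDet] at h ⊢
      linear_combination h
    exact (hv _ _).1 ((mul_eq_zero.1 h3).resolve_left fun h => hx ((hv _ _).1 h))
  refine Finset.sum_nbij _ (fun _ _ => Finset.mem_univ _) hinj ?_ (fun _ _ => rfl)
  refine Finset.surjOn_of_injOn_of_card_le _ (fun _ _ => Finset.mem_univ _) hinj ?_
  rw [Finset.card_erase_of_mem (Finset.mem_univ _), Finset.card_univ, Finset.card_univ, hcard,
    Nat.add_sub_cancel]

lemma sum_planeDet_div' {v : ι → F × F} (hv : ∀ x y, planeDet (v x) (v y) = 0 ↔ x = y)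
    (hcard : Fintype.card ι = Fintype.card F + 1) {f : F → M} (hf : f 0 = 0) {y y' : ι}
    (hy : y ≠ y') :
    ∑ x, f (planeDet (v x) (v y) / planeDet (v x) (v y')) = ∑ u, f u := by
  rw [← sum_planeDet_div hv hcard hf hy]
  refine Finset.sum_congr rfl fun x _ => ?_
  rw [planeDet_swap (v x), planeDet_swap (v x), neg_div_neg_eq]

lemma sum_planeDet_div_self {v : ι → F × F} (hv : ∀ x y, planeDet (v x) (v y) = 0 ↔ x = y)
    (hcard : Fintype.card ι = Fintype.card F + 1) {f : F → M} (hf : f 0 = 0) (x : ι) :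
    ∑ y, f (planeDet (v x) (v y) / planeDet (v x) (v y)) = Fintype.card F • f 1 := by
  rw [← Finset.add_sum_erase _ _ (Finset.mem_univ x), (hv x x).2 rfl, div_zero, hf, zero_add]
  rw [Finset.sum_congr rfl (g := fun _ => f 1), Finset.sum_const,
    Finset.card_erase_of_mem (Finset.mem_univ _), Finset.card_univ, hcard, Nat.add_sub_cancel]
  intro y hy
  rw [div_self fun h => (Finset.mem_erase.1 hy).1 ((hv _ _).1 h).symm]

lemma sum_planeDet_div_self' {v : ι → F × F} (hv : ∀ x y, planeDet (v x) (v y) = 0 ↔ x = y)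
    (hcard : Fintype.card ι = Fintype.card F + 1) {f : F → M} (hf : f 0 = 0) (y : ι) :
    ∑ x, f (planeDet (v x) (v y) / planeDet (v x) (v y)) = Fintype.card F • f 1 := by
  rw [← sum_planeDet_div_self hv hcard hf y]
  refine Finset.sum_congr rfl fun x _ => ?_
  rw [planeDet_swap (v x), neg_div_neg_eq]

end ProjectiveLine

section Blocks

variable {F ι κ : Type*} [Field F] [Fintype F] [Fintype ι] [DecidableEq ι] [Fintype κ]
  [DecidableEq κ]

/-- A representation of a group with zero by integer matrices whose values on units are
orthogonal. -/
structure IsOrthogonalRep (R : F → Matrix κ κ ℤ) : Prop where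
  map_zero : R 0 = 0
  map_one : R 1 = 1
  map_mul : ∀ u w, R (u * w) = R u * R w
  map_inv : ∀ u, R u⁻¹ = (R u)ᵀ

/-- The block matrix whose `(x, y)` block is `D * R (det (v x, v y))`. -/
def planeBlocks (v : ι → F × F) (D : Matrix κ κ ℤ) (R : F → Matrix κ κ ℤ) :
    Matrix (ι × κ) (ι × κ) ℤ :=
  Matrix.of fun p q => (D * R (planeDet (v p.1) (v q.1))) p.2 q.2

lemma planeBlocks_mul_transpose {v : ι → F × F}
    (hv : ∀ x y, planeDet (v x) (v y) = 0 ↔ x = y)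
    (hcard : Fintype.card ι = Fintype.card F + 1) (D : Matrix κ κ ℤ) {R : F → Matrix κ κ ℤ}
    (hR : IsOrthogonalRep R) (p q : ι × κ) :
    (planeBlocks v D R * (planeBlocks v D R)ᵀ) p q =
      if p.1 = q.1 then Fintype.card F * (D * Dᵀ) p.2 q.2
      else (D * (∑ u, R u) * Dᵀ) p.2 q.2 := by
  have h : (planeBlocks v D R * (planeBlocks v D R)ᵀ) p q =
      (D * (∑ y, R (planeDet (v p.1) (v y) / planeDet (v q.1) (v y))) * Dᵀ) p.2 q.2 := by
    rw [Matrix.mul_sum, Matrix.sum_mul, Matrix.sum_apply, Matrix.mul_apply, Fintype.sum_prod_type]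
    refine Finset.sum_congr rfl fun y _ => ?_
    rw [div_eq_mul_inv, hR.map_mul, hR.map_inv, ← Matrix.mul_assoc, Matrix.mul_assoc _ _ Dᵀ,
      ← Matrix.transpose_mul, Matrix.mul_apply]
    rfl
  rw [h]
  split_ifs with hpq
  · rw [hpq, sum_planeDet_div_self hv hcard hR.map_zero, hR.map_one, Matrix.mul_smul,
      Matrix.mul_one, Matrix.smul_mul, Matrix.smul_apply, nsmul_eq_mul]
  · rw [sum_planeDet_div hv hcard hR.map_zero hpq]

lemma planeBlocks_transpose_mul {v : ι → F × F}
    (hv : ∀ x y, planeDet (v x) (v y) = 0 ↔ x = y)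
    (hcard : Fintype.card ι = Fintype.card F + 1) (D : Matrix κ κ ℤ) {R : F → Matrix κ κ ℤ}
    (hR : IsOrthogonalRep R) (hcomm : ∀ u, Dᵀ * D * R u = R u * (Dᵀ * D)) (p q : ι × κ) :
    ((planeBlocks v D R)ᵀ * planeBlocks v D R) p q =
      if p.1 = q.1 then Fintype.card F * (Dᵀ * D) p.2 q.2
      else ((∑ u, R u) * (Dᵀ * D)) p.2 q.2 := by
  have h : ((planeBlocks v D R)ᵀ * planeBlocks v D R) p q =
      ((∑ x, R (planeDet (v x) (v q.1) / planeDet (v x) (v p.1))) * (Dᵀ * D)) p.2 q.2 := by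
    rw [Matrix.sum_mul, Matrix.sum_apply, Matrix.mul_apply, Fintype.sum_prod_type]
    refine Finset.sum_congr rfl fun y _ => ?_
    rw [div_eq_inv_mul, hR.map_mul, hR.map_inv, Matrix.mul_assoc, ← hcomm, Matrix.mul_assoc Dᵀ,
      ← Matrix.mul_assoc _ Dᵀ, ← Matrix.transpose_mul, Matrix.mul_apply]
    rfl
  rw [h]
  split_ifs with hpq
  · rw [hpq, sum_planeDet_div_self' hv hcard hR.map_zero, hR.map_one, Matrix.smul_mul,
      Matrix.one_mul,
      Matrix.smul_apply, nsmul_eq_mul]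
  · rw [sum_planeDet_div' hv hcard hR.map_zero (Ne.symm hpq)]

end Blocks

section Negacyclic

variable {n : ℕ}

/-- The function on `ℤ / 2n` supported at `0` and `n`, with values `1` and `ε`. -/
def twoPoint (n : ℕ) (ε : ℤ) (x : ZMod (2 * n)) : ℤ :=
  if x = 0 then 1 else if x = n then ε else 0

lemma natCast_add_self (n : ℕ) : (n : ZMod (2 * n)) + n = 0 := by
  rw [← two_mul]
  exact_mod_cast ZMod.natCast_self (2 * n)

lemma natCast_ne_zero_of_pos (hn : 0 < n) : (n : ZMod (2 * n)) ≠ 0 := by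
  rw [Ne, ZMod.natCast_eq_zero_iff]
  intro h
  have := Nat.le_of_dvd hn h
  omega

lemma twoPoint_neg (ε : ℤ) (x : ZMod (2 * n)) : twoPoint n ε (-x) = twoPoint n ε x := by
  have h : -x = n ↔ x = n := by
    rw [neg_eq_iff_eq_neg, ← eq_neg_of_add_eq_zero_left (natCast_add_self n)]
  simp [twoPoint, h]

lemma twoPoint_add_half (hn : 0 < n) {ε : ℤ} (hε : ε * ε = 1) (x : ZMod (2 * n)) :
    twoPoint n ε (x + n) = ε * twoPoint n ε x := by
  have h : x + n = 0 ↔ x = n := by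
    rw [← natCast_add_self n, add_left_inj]
  have h0 := (natCast_ne_zero_of_pos hn).symm
  by_cases h1 : x = 0
  · subst h1
    simp [twoPoint, h0.symm]
  · by_cases h2 : x = n
    · simp [twoPoint, h2, natCast_add_self, h0.symm, hε]
    · simp [twoPoint, h1, h2, h]

lemma natCast_sub_twoPoint (ε : ℤ) (a b : Fin n) :
    twoPoint n ε ((a : ℕ) - (b : ℕ)) = if a = b then 1 else 0 := by
  have ha := a.2
  have hb := b.2
  have h0 : ((a : ℕ) : ZMod (2 * n)) - (b : ℕ) = 0 ↔ a = b := by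
    rw [sub_eq_zero, ZMod.natCast_eq_natCast_iff', Nat.mod_eq_of_lt (by omega),
      Nat.mod_eq_of_lt (by omega), Fin.ext_iff]
  have h1 : ((a : ℕ) : ZMod (2 * n)) - (b : ℕ) ≠ n := by
    rw [Ne, sub_eq_iff_eq_add, ← Nat.cast_add, ZMod.natCast_eq_natCast_iff',
      Nat.mod_eq_of_lt (by omega), Nat.mod_eq_of_lt (by omega)]
    omega
  simp [twoPoint, h0, h1]

lemma exists_fin_natCast (hn : 0 < n) (x : ZMod (2 * n)) :
    ∃ b : Fin n, x = (b : ℕ) ∨ x = (b : ℕ) + n := by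
  have : NeZero (2 * n) := ⟨by omega⟩
  have hx := ZMod.val_lt x
  by_cases h : x.val < n
  · exact ⟨⟨x.val, h⟩, Or.inl (ZMod.natCast_zmod_val x).symm⟩
  · refine ⟨⟨x.val - n, by omega⟩, Or.inr ?_⟩
    rw [← Nat.cast_add, Nat.sub_add_cancel (by omega), ZMod.natCast_zmod_val]

lemma sum_twoPoint (hn : 0 < n) [NeZero (2 * n)] (ε : ℤ) : ∑ x, twoPoint n ε x = 1 + ε := by
  have h0 := natCast_ne_zero_of_pos hn
  have h : ∀ x, twoPoint n ε x =
      (if x = 0 then 1 else 0) + (if x = (n : ZMod (2 * n)) then ε else 0) := by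
    intro x
    by_cases h1 : x = 0
    · subst h1
      simp [twoPoint, h0.symm]
    · simp [twoPoint, h1]
  simp [h, Finset.sum_add_distrib]

lemma abs_twoPoint_neg_one (x : ZMod (2 * n)) : |twoPoint n (-1) x| = twoPoint n 1 x := by
  unfold twoPoint
  split_ifs <;> rfl

/-- The `t`-th power of the cyclic (`ε = 1`) or negacyclic (`ε = -1`) shift. -/
def shift (n : ℕ) (ε : ℤ) (t : ZMod (2 * n)) : Matrix (Fin n) (Fin n) ℤ :=
  Matrix.of fun a b => twoPoint n ε (t + (a : ℕ) - (b : ℕ))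

lemma shift_zero (ε : ℤ) : shift n ε 0 = 1 := by
  ext a b
  simp [shift, natCast_sub_twoPoint, Matrix.one_apply]

lemma shift_neg (ε : ℤ) (t : ZMod (2 * n)) : shift n ε (-t) = (shift n ε t)ᵀ := by
  ext a b
  simp only [shift, Matrix.of_apply, Matrix.transpose_apply]
  rw [← twoPoint_neg]
  congr 1
  ring

lemma shift_add (hn : 0 < n) {ε : ℤ} (hε : ε * ε = 1) (t u : ZMod (2 * n)) :
    shift n ε (t + u) = shift n ε t * shift n ε u := by
  ext a c
  simp only [shift, Matrix.of_apply, Matrix.mul_apply]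
  rw [add_right_comm]
  obtain ⟨b, hb | hb⟩ := exists_fin_natCast hn (t + (a : ℕ))
  · simp [hb, natCast_sub_twoPoint, add_comm u]
  · have h : ∀ b' : Fin n, twoPoint n ε ((b : ℕ) + n - (b' : ℕ)) = ε * if b = b' then 1 else 0 :=
      fun b' => by rw [add_sub_right_comm, twoPoint_add_half hn hε, natCast_sub_twoPoint]
    simp only [hb, h]
    rw [show (b : ℕ) + (n : ZMod (2 * n)) + u - (c : ℕ) = u + (b : ℕ) - (c : ℕ) + n by ring,
      twoPoint_add_half hn hε]
    simp

lemma sum_shift (hn : 0 < n) [NeZero (2 * n)] (ε : ℤ) :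
    ∑ t, shift n ε t = (1 + ε) • allOnes (Fin n) := by
  ext a b
  rw [Matrix.sum_apply]
  simp only [shift, Matrix.of_apply, add_sub_assoc]
  rw [← sum_twoPoint hn ε]
  simpa using
    Equiv.sum_comp (Equiv.addRight (((a : ℕ) : ZMod (2 * n)) - (b : ℕ))) (twoPoint n ε)

lemma exists_shift_apply_eq_zero (hn : 0 < n) (t : ZMod (2 * n)) (c : Fin n) :
    ∃ b : Fin n, ∀ b', b' ≠ b → shift n (-1) t b' c = 0 := by
  obtain ⟨b, hb⟩ := exists_fin_natCast hn ((c : ℕ) - t)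
  refine ⟨b, fun b' h => ?_⟩
  simp only [shift, Matrix.of_apply]
  rw [← twoPoint_neg, show -(t + (b' : ℕ) - (c : ℕ)) = (c : ℕ) - t - (b' : ℕ) by ring]
  rcases hb with hb | hb
  · rw [hb, natCast_sub_twoPoint, if_neg h.symm]
  · rw [hb, add_sub_right_comm, twoPoint_add_half hn (by norm_num), natCast_sub_twoPoint,
      if_neg h.symm, mul_zero]

end Negacyclic

section DiscreteLog

variable {F : Type*} [Field F] [DecidableEq F]

/-- A surjective homomorphism from the units of a finite field onto `ℤ / N` takes each value
equally often. -/
lemma exists_discreteLog [Fintype F] {N : ℕ} [NeZero N] (hN : N ∣ Fintype.card F - 1) :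
    ∃ L : Fˣ →* Multiplicative (ZMod N), ∀ {M : Type} [AddCommMonoid M] (f : ZMod N → M),
      ∑ u, f (L u).toAdd = ((Fintype.card F - 1) / N) • ∑ t, f t := by
  have hc : Nat.card Fˣ = Fintype.card F - 1 := by rw [Nat.card_units, Nat.card_eq_fintype_card]
  let e := (zmodCyclicMulEquiv (inferInstance : IsCyclic Fˣ)).symm
  let L : Fˣ →* Multiplicative (ZMod N) :=
    (AddMonoidHom.toMultiplicative (ZMod.castHom (hc ▸ hN) (ZMod N)).toAddMonoidHom).comp
      e.toMonoidHom
  have hL : Function.Surjective L :=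
    (ZMod.castHom_surjective (hc ▸ hN)).comp e.surjective
  have hfib : ∀ t, Finset.card {u | L u = t} = Finset.card {u | L u = 1} := fun t =>
    MonoidHom.card_fiber_eq_of_mem_range L (hL t) (hL 1)
  have hcard : Finset.card {u | L u = 1} = (Fintype.card F - 1) / N := by
    have h : Fintype.card Fˣ = ∑ t, Finset.card {u | L u = t} :=
      Finset.card_eq_sum_card_fiberwise fun _ _ => Finset.mem_univ _
    simp only [hfib, Finset.sum_const, Finset.card_univ, smul_eq_mul] at h
    rw [← hc, Nat.card_eq_fintype_card, h, Fintype.card_multiplicative, ZMod.card,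
      Nat.mul_div_cancel_left _ (NeZero.pos N)]
  refine ⟨L, fun f => ?_⟩
  rw [← Finset.sum_fiberwise Finset.univ L, Finset.smul_sum,
    ← Multiplicative.ofAdd.sum_comp]
  refine Finset.sum_congr rfl fun t _ => ?_
  rw [← hcard, ← hfib (Multiplicative.ofAdd t), ← Finset.sum_const]
  refine Finset.sum_congr rfl fun u hu => ?_
  rw [(Finset.mem_filter.1 hu).2, toAdd_ofAdd]

variable {n : ℕ}

/-- The representation of `F` by powers of the cyclic or negacyclic shift, extended by zero. -/
def shiftRep (L : Fˣ →* Multiplicative (ZMod (2 * n))) (ε : ℤ) (u : F) :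
    Matrix (Fin n) (Fin n) ℤ :=
  if h : u = 0 then 0 else shift n ε (L (Units.mk0 u h)).toAdd

lemma isOrthogonalRep_shiftRep (hn : 0 < n) (L : Fˣ →* Multiplicative (ZMod (2 * n))) {ε : ℤ}
    (hε : ε * ε = 1) : IsOrthogonalRep (shiftRep L ε) where
  map_zero := by simp [shiftRep]
  map_one := by simp [shiftRep, shift_zero]
  map_mul u w := by
    by_cases hu : u = 0
    · simp [shiftRep, hu]
    by_cases hw : w = 0
    · simp [shiftRep, hw]
    simp [shiftRep, hu, hw, Units.mk0_mul, shift_add hn hε]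
  map_inv u := by
    by_cases hu : u = 0
    · simp [shiftRep, hu]
    have h : Units.mk0 u⁻¹ (inv_ne_zero hu) = (Units.mk0 u hu)⁻¹ := by
      ext
      simp
    simp [shiftRep, hu, h, shift_neg]

lemma sum_shiftRep [Fintype F] (L : Fˣ →* Multiplicative (ZMod (2 * n))) (ε : ℤ) :
    ∑ u, shiftRep L ε u = ∑ u : Fˣ, shift n ε (L u).toAdd := by
  rw [← Finset.add_sum_erase _ _ (Finset.mem_univ (0 : F))]
  simp only [shiftRep, dite_true, zero_add]
  symm
  refine Finset.sum_bij (fun u _ => (u : F)) (by simp) (fun _ _ _ _ h => Units.ext h) ?_ ?_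
  · intro u hu
    exact ⟨Units.mk0 u (Finset.mem_erase.1 hu).1, Finset.mem_univ _, rfl⟩
  · intro u _
    simp

lemma shiftRep_commutes_allOnes (hn : 0 < n) (L : Fˣ →* Multiplicative (ZMod (2 * n))) (u : F) :
    shiftRep L 1 u * allOnes (Fin n) = allOnes (Fin n) * shiftRep L 1 u := by
  by_cases hu : u = 0
  · simp [shiftRep, hu]
  · simp only [shiftRep, hu, dite_false]
    have h : ∀ t, shift n 1 t * allOnes (Fin n) = allOnes (Fin n) := by
      intro t
      ext a c
      obtain ⟨b, hb⟩ := exists_fin_natCast hn (t + (a : ℕ))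
      have h1 : ∀ b' : Fin n, twoPoint n 1 (t + (a : ℕ) - (b' : ℕ)) = if b = b' then 1 else 0 := by
        intro b'
        rcases hb with hb | hb
        · rw [hb, natCast_sub_twoPoint]
        · rw [hb, add_sub_right_comm, twoPoint_add_half hn (by norm_num), natCast_sub_twoPoint,
            one_mul]
      simp [Matrix.mul_apply, shift, h1]
    have h2 := congrArg Matrix.transpose (h (-(L (Units.mk0 u hu)).toAdd))
    rw [Matrix.transpose_mul, ← shift_neg, neg_neg, allOnes_transpose] at h2
    rw [h, h2]

lemma abs_shiftRep_neg_one (L : Fˣ →* Multiplicative (ZMod (2 * n))) (u : F) (a b : Fin n) :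
    |shiftRep L (-1) u a b| = shiftRep L 1 u a b := by
  unfold shiftRep
  split_ifs
  · simp
  · exact abs_twoPoint_neg_one _

lemma shiftRep_neg_one_apply (L : Fˣ →* Multiplicative (ZMod (2 * n))) (u : F) (a b : Fin n) :
    shiftRep L (-1) u a b = -1 ∨ shiftRep L (-1) u a b = 0 ∨ shiftRep L (-1) u a b = 1 := by
  unfold shiftRep
  split_ifs
  · simp
  · simp only [shift, twoPoint, Matrix.of_apply]
    split_ifs <;> simp

lemma exists_shiftRep_apply_eq_zero (hn : 0 < n) (L : Fˣ →* Multiplicative (ZMod (2 * n))) (u : F)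
    (c : Fin n) : ∃ b : Fin n, ∀ b', b' ≠ b → shiftRep L (-1) u b' c = 0 := by
  unfold shiftRep
  split_ifs
  · exact ⟨c, fun _ _ => rfl⟩
  · exact exists_shift_apply_eq_zero hn _ c

lemma planeBlocks_abs {ι : Type*} (hn : 0 < n) (v : ι → F × F) (C : Matrix (Fin n) (Fin n) ℤ)
    (h01 : ∀ i j, C i j = -1 ∨ C i j = 0 ∨ C i j = 1)
    (L : Fˣ →* Multiplicative (ZMod (2 * n))) :
    (∀ x y, planeBlocks v C (shiftRep L (-1)) x y = -1 ∨
      planeBlocks v C (shiftRep L (-1)) x y = 0 ∨ planeBlocks v C (shiftRep L (-1)) x y = 1) ∧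
    ((planeBlocks v C (shiftRep L (-1))).map fun t => |t|) =
      planeBlocks v (C.map fun t => |t|) (shiftRep L 1) := by
  have key : ∀ a c u, ∃ b, (C * shiftRep L (-1) u) a c = C a b * shiftRep L (-1) u b c ∧
      ((C.map fun t => |t|) * shiftRep L 1 u) a c = |C a b| * |shiftRep L (-1) u b c| := by
    intro a c u
    obtain ⟨b, hb⟩ := exists_shiftRep_apply_eq_zero hn L u c
    refine ⟨b, ?_, ?_⟩
    · rw [Matrix.mul_apply, Finset.sum_eq_single b (fun b' _ h => by rw [hb b' h, mul_zero])
        (by simp)]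
    · simp only [Matrix.mul_apply, Matrix.map_apply, ← abs_shiftRep_neg_one]
      rw [Finset.sum_eq_single b (fun b' _ h => by rw [hb b' h, abs_zero, mul_zero]) (by simp)]
  refine ⟨fun x y => ?_, ?_⟩
  · obtain ⟨b, hb, -⟩ := key x.2 y.2 (planeDet (v x.1) (v y.1))
    simp only [planeBlocks, Matrix.of_apply, hb]
    rcases h01 x.2 b with h | h | h <;>
      rcases shiftRep_neg_one_apply L (planeDet (v x.1) (v y.1)) b y.2 with h' | h' | h' <;>
      simp [h, h']
  · ext x y
    obtain ⟨b, hb, hb'⟩ := key x.2 y.2 (planeDet (v x.1) (v y.1))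
    simp only [planeBlocks, Matrix.of_apply, Matrix.map_apply, hb, hb', abs_mul]

end DiscreteLog

theorem stmt8 (n k lam : ℕ) (hn : 0 < n) (hk : 0 < k) (hlam : 0 < lam)
    -- there exists a BGW(n, k, λ) over {1, -1}
    (C : Matrix (Fin n) (Fin n) ℤ)
    (hC01 : ∀ i j, C i j = -1 ∨ C i j = 0 ∨ C i j = 1)
    (hCW : C * Cᵀ = (k : ℤ) • 1)
    (hCB : (C.map fun t => |t|) * (C.map fun t => |t|)ᵀ =
      ((k : ℤ) - (lam : ℤ)) • 1 + (lam : ℤ) • allOnes (Fin n)) :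
    {m : ℕ | m.Prime ∧
      ∃ W : Matrix (Fin (m + 1) × Fin n) (Fin (m + 1) × Fin n) ℤ,
        (∀ x y, W x y = -1 ∨ W x y = 0 ∨ W x y = 1) ∧
        W * Wᵀ = ((m : ℤ) * k) • 1 ∧
        (W.map fun t => |t|) * (W.map fun t => |t|)ᵀ =
          ((m : ℤ) * k) • 1 + ((m : ℤ) * lam) • (blockJ (m + 1) n - 1) +
            ((((m - 1) / n : ℕ) : ℤ) * (k : ℤ) ^ 2) •
              (allOnes (Fin (m + 1) × Fin n) - blockJ (m + 1) n) ∧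
        (W.map fun t => |t|)ᵀ * (W.map fun t => |t|) =
          ((m : ℤ) * k) • 1 + ((m : ℤ) * lam) • (blockJ (m + 1) n - 1) +
            ((((m - 1) / n : ℕ) : ℤ) * (k : ℤ) ^ 2) •
              (allOnes (Fin (m + 1) × Fin n) - blockJ (m + 1) n)}.Infinite := by
  have h2n : 2 * n ≠ 0 := by omega
  have : NeZero (2 * n) := ⟨h2n⟩
  obtain ⟨hrow, hdual, hcount⟩ := balanced_abs hC01 hCW hCB
  have hksq := hcount ⟨⟨0, hn⟩⟩
  rw [Fintype.card_fin] at hksq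
  refine (Nat.infinite_setOfPred_prime_modEq_one h2n).mono ?_
  rintro m ⟨hm, hmod⟩
  refine ⟨hm, ?_⟩
  have : Fact m.Prime := ⟨hm⟩
  have hdvd : 2 * n ∣ m - 1 := (Nat.modEq_iff_dvd' hm.one_le).1 hmod.symm
  have hF : Fintype.card (ZMod m) = m := ZMod.card m
  obtain ⟨L, hL⟩ := exists_discreteLog (F := ZMod m) (hF.symm ▸ hdvd)
  have hquot : (m - 1) / n = (m - 1) / (2 * n) * 2 := by
    obtain ⟨q, hq⟩ := hdvd
    rw [hq, Nat.mul_div_cancel_left _ (by omega), mul_right_comm, Nat.mul_div_cancel _ hn, mul_comm]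
  have hcard : Fintype.card (Fin (m + 1)) = Fintype.card (ZMod m) + 1 := by simp [hF]
  let e : Fin (m + 1) ≃ Option (ZMod m) :=
    Fintype.equivOfCardEq (by rw [hcard, Fintype.card_option])
  let v := projPoint ∘ e
  have hv : ∀ x y, planeDet (v x) (v y) = 0 ↔ x = y := fun x y => by
    simp [v, planeDet_projPoint_eq_zero]
  have hR := isOrthogonalRep_shiftRep hn L (ε := -1) (by norm_num)
  have hR' := isOrthogonalRep_shiftRep hn L (ε := 1) (by norm_num)
  have hsum : ∑ u, shiftRep L (-1) u = 0 := by
    rw [sum_shiftRep, hL, sum_shift hn]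
    simp
  have hsum' : ∑ u, shiftRep L 1 u = (((m - 1) / n : ℕ) : ℤ) • allOnes (Fin n) := by
    rw [sum_shiftRep, hL, sum_shift hn, hquot, hF, ← natCast_zsmul, smul_smul]
    norm_num
  have hcomm : ∀ u, (C.map fun t => |t|)ᵀ * (C.map fun t => |t|) * shiftRep L 1 u =
      shiftRep L 1 u * ((C.map fun t => |t|)ᵀ * (C.map fun t => |t|)) := fun u => by
    rw [hdual]
    simp only [Matrix.add_mul, Matrix.mul_add, Matrix.smul_mul, Matrix.mul_smul, Matrix.one_mul,
      Matrix.mul_one, shiftRep_commutes_allOnes hn]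
  have hrow' : allOnes (Fin n) * (C.map fun t => |t|)ᵀ = (k : ℤ) • allOnes (Fin n) := by
    simpa [-zsmul_eq_mul, -natCast_zsmul] using congrArg Matrix.transpose hrow
  obtain ⟨h01, habs⟩ := planeBlocks_abs hn v C hC01 L
  refine ⟨planeBlocks v C (shiftRep L (-1)), h01, ?_, ?_, ?_⟩
  · ext ⟨i, a⟩ ⟨j, b⟩
    rw [planeBlocks_mul_transpose hv hcard C hR, hCW, hsum, hF]
    simp only [Matrix.smul_apply, Matrix.one_apply, Prod.mk.injEq, smul_eq_mul, Matrix.mul_zero,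
      Matrix.zero_mul, Matrix.zero_apply]
    by_cases hij : i = j <;> simp [hij]
  · rw [habs]
    ext ⟨i, a⟩ ⟨j, b⟩
    rw [planeBlocks_mul_transpose hv hcard _ hR', hCB, hsum', Matrix.mul_smul, Matrix.smul_mul,
      hrow, Matrix.smul_mul, hrow', hF]
    simp only [Matrix.add_apply, Matrix.sub_apply, Matrix.smul_apply, Matrix.one_apply,
      allOnes_apply, blockJ, Matrix.of_apply, Prod.mk.injEq, smul_eq_mul]
    by_cases hij : i = j
    · by_cases hab : a = b <;> simp [hij, hab]
    · simp [hij, sq]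
  · rw [habs]
    ext ⟨i, a⟩ ⟨j, b⟩
    rw [planeBlocks_transpose_mul hv hcard _ hR' hcomm, hdual, hsum', hF]
    simp only [Matrix.mul_add, Matrix.smul_mul, Matrix.mul_smul, Matrix.mul_one,
      allOnes_mul_allOnes, Fintype.card_fin, hksq, Matrix.add_apply, Matrix.sub_apply,
      Matrix.smul_apply, Matrix.one_apply,
      allOnes_apply, blockJ, Matrix.of_apply, Prod.mk.injEq, smul_eq_mul]
    by_cases hij : i = j
    · by_cases hab : a = b <;> simp [hij, hab]
    · simp only [hij, false_and, if_false]
      ring
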